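/- The parity operator Π defined on finitely supported sequences by (Πψ)(n) = (−1)^n·ψ(n) satisfies 𝔏*_L(Π) = 0, i.e. L†·Π·L = (L†L·Π + Π·L†L)/2. -/

import Mathlib

/-!
STATEMENT 12: The parity operator Π defined on finitely supported sequences by
(Πψ)(n) = (−1)^n·ψ(n) satisfies 𝔏*_L(Π) = 0, i.e.
L†·Π·L = (L†L·Π + Π·L†L)/2, for L = a² − α²·I with α > 0.
-/

noncomputable section

abbrev FockSpace : Type := ℕ →₀ ℂ

/-- The annihilation operator `a`: `a e_n = √n e_{n-1}` (and `a e_0 = 0`),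
equivalently `(a ψ)(n) = √(n+1) ψ(n+1)`. -/
noncomputable def ann : Module.End ℂ FockSpace :=
  Finsupp.lsum ℂ fun n => (Real.sqrt n : ℂ) • Finsupp.lsingle (n - 1)

/-- The creation operator `a†`: `a† e_n = √(n+1) e_{n+1}`. -/
noncomputable def cre : Module.End ℂ FockSpace :=
  Finsupp.lsum ℂ fun n => (Real.sqrt (n + 1) : ℂ) • Finsupp.lsingle (n + 1)

/-- `L = a² − α²·I`. -/
noncomputable def Lop (α : ℝ) : Module.End ℂ FockSpace :=
  ann ^ 2 - ((α : ℂ) ^ 2) • 1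

/-- `L† = (a†)² − α²·I`. -/
noncomputable def Ldag (α : ℝ) : Module.End ℂ FockSpace :=
  cre ^ 2 - ((α : ℂ) ^ 2) • 1

/-- The parity operator `Π`: `(Πψ)(n) = (−1)^n ψ(n)`. -/
noncomputable def parity : Module.End ℂ FockSpace :=
  Finsupp.lsum ℂ fun n => ((-1 : ℂ) ^ n) • Finsupp.lsingle n

theorem ann_single (n : ℕ) (c : ℂ) :
    ann (Finsupp.single n c) = (Real.sqrt n : ℂ) • Finsupp.single (n - 1) c := by
  simp only [ann, Finsupp.lsum_single, LinearMap.smul_apply, Finsupp.lsingle_apply]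

theorem cre_single (n : ℕ) (c : ℂ) :
    cre (Finsupp.single n c) = (Real.sqrt (n + 1) : ℂ) • Finsupp.single (n + 1) c := by
  simp only [cre, Finsupp.lsum_single, LinearMap.smul_apply, Finsupp.lsingle_apply]

theorem parity_single (n : ℕ) (c : ℂ) :
    parity (Finsupp.single n c) = (-1 : ℂ) ^ n • Finsupp.single n c := by
  simp only [parity, Finsupp.lsum_single, LinearMap.smul_apply, Finsupp.lsingle_apply]

/-- Parity anticommutes with the annihilation operator. -/
theorem parity_ann (ψ : FockSpace) : parity (ann ψ) = -ann (parity ψ) := by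
  induction ψ using Finsupp.induction_linear with
  | zero => simp only [map_zero, neg_zero]
  | add f g hf hg => simp only [map_add, hf, hg, neg_add]
  | single n c =>
    rcases n with _ | n
    · simp [ann_single, parity_single]
    · simp only [ann_single, parity_single, map_smul, Nat.add_sub_cancel, smul_smul, ← neg_smul]
      congr 1
      ring

/-- Parity anticommutes with the creation operator. -/
theorem parity_cre (ψ : FockSpace) : parity (cre ψ) = -cre (parity ψ) := by
  induction ψ using Finsupp.induction_linear with
  | zero => simp only [map_zero, neg_zero]
  | add f g hf hg => simp only [map_add, hf, hg, neg_add]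
  | single n c =>
    simp only [cre_single, parity_single, map_smul, smul_smul, ← neg_smul]
    congr 1
    ring

theorem parity_Lop (α : ℝ) (ψ : FockSpace) : parity (Lop α ψ) = Lop α (parity ψ) := by
  simp only [Lop, pow_two ann, LinearMap.sub_apply, LinearMap.smul_apply, Module.End.mul_apply,
    Module.End.one_apply, map_sub, map_smul, parity_ann, map_neg, neg_neg]

theorem parity_Ldag (α : ℝ) (ψ : FockSpace) : parity (Ldag α ψ) = Ldag α (parity ψ) := by
  simp only [Ldag, pow_two cre, LinearMap.sub_apply, LinearMap.smul_apply, Module.End.mul_apply,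
    Module.End.one_apply, map_sub, map_smul, parity_cre, map_neg, neg_neg]

theorem stmt12 (α : ℝ) (hα : 0 < α) :
    Ldag α * parity * Lop α =
      (2⁻¹ : ℂ) • (Ldag α * Lop α * parity + parity * (Ldag α * Lop α)) := by
  refine LinearMap.ext fun ψ => ?_
  simp only [Module.End.mul_apply, LinearMap.smul_apply, LinearMap.add_apply, parity_Lop,
    parity_Ldag]
  rw [← two_smul ℂ, smul_smul, inv_mul_cancel₀ two_ne_zero, one_smul]

end
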